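/- arXiv:2402.05051 — 2 statements merged into one kernel-verified Lean document; each statement's English description precedes it below -/
import Mathlib

section
/- Let Q be a finite acyclic quiver, K a field, and N a thin representation of Q whose support supp(N) has underlying graph a tree (connected with no cycles). Then N is isomorphic to the canonical representation of supp(N), i.e., the thin representation C with C_a = K for each vertex a of supp(N), C_a = 0 otherwise, C_α = id_K for each arrow α of supp(N), and C_α = 0 otherwise. -/
open scoped Classical

namespace QR

/-- A finite quiver: finite sets of vertices and arrows with source and target maps. -/
structure FinQuiver where
  V : Type
  A : Type
  [fintypeV : Fintype V]
  [fintypeA : Fintype A]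
  s : A → V
  t : A → V

attribute [instance] FinQuiver.fintypeV FinQuiver.fintypeA

/-- One oriented step along an arrow of `Q`. -/
def FinQuiver.Step (Q : FinQuiver) (v w : Q.V) : Prop := ∃ a : Q.A, Q.s a = v ∧ Q.t a = w

/-- `Q` is acyclic: it contains no oriented cycle. -/
def FinQuiver.Acyclic (Q : FinQuiver) : Prop := ∀ v : Q.V, ¬ Relation.TransGen Q.Step v v

/-- A finite-dimensional `K`-linear representation of the quiver `Q`. -/
structure Rep (K : Type) [Field K] (Q : FinQuiver) where
  space : Q.V → Type
  [instAddCommGroup : ∀ v, AddCommGroup (space v)]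
  [instModule : ∀ v, Module K (space v)]
  [instFinite : ∀ v, FiniteDimensional K (space v)]
  map : ∀ a : Q.A, space (Q.s a) →ₗ[K] space (Q.t a)

attribute [instance] Rep.instAddCommGroup Rep.instModule Rep.instFinite

variable {K : Type} [Field K] {Q : FinQuiver}

/-- A morphism of representations: linear maps commuting with the structure maps. -/
structure Hom (N M : Rep K Q) where
  app : ∀ v, N.space v →ₗ[K] M.space v
  comm : ∀ a : Q.A, (M.map a).comp (app (Q.s a)) = (app (Q.t a)).comp (N.map a)

/-- Composition of morphisms of representations. -/
def Hom.comp {X Y Z : Rep K Q} (g : Hom Y Z) (f : Hom X Y) : Hom X Z where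
  app v := (g.app v).comp (f.app v)
  comm a := by
    ext x
    have h1 := LinearMap.congr_fun (f.comm a) x
    have h2 := LinearMap.congr_fun (g.comm a) (f.app (Q.s a) x)
    simp only [LinearMap.comp_apply] at h1 h2 ⊢
    rw [h2, h1]

/-- A representation is nonzero if some vertex space contains a nonzero vector. -/
def Rep.Nonzero (M : Rep K Q) : Prop := ∃ v, ∃ x : M.space v, x ≠ 0

/-- A representation is zero if all its vertex spaces are trivial. -/
def IsZeroRep (M : Rep K Q) : Prop := ∀ v, ∀ x : M.space v, x = 0

/-- Two representations are isomorphic iff there is a morphism between them that is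
bijective at every vertex. -/
def Iso (N M : Rep K Q) : Prop := ∃ f : Hom N M, ∀ v, Function.Bijective (f.app v)

/-- The direct sum of two representations. -/
noncomputable def dsum (N N' : Rep K Q) : Rep K Q where
  space v := N.space v × N'.space v
  map a := (N.map a).prodMap (N'.map a)

/-- A representation is indecomposable if it is nonzero and not isomorphic to the
direct sum of two nonzero representations. -/
def Indecomposable (M : Rep K Q) : Prop :=
  M.Nonzero ∧ ¬ ∃ N N' : Rep K Q, N.Nonzero ∧ N'.Nonzero ∧ Iso M (dsum N N')

/-- A representation is thin if all its vertex spaces have dimension at most one. -/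
def Rep.Thin (M : Rep K Q) : Prop := ∀ v, Module.finrank K (M.space v) ≤ 1

/-- Vertices of the support of `M`. -/
def suppV (M : Rep K Q) : Set Q.V := {v | ∃ x : M.space v, x ≠ 0}

/-- Arrows of the support of `M`. -/
def suppA (M : Rep K Q) : Set Q.A := {a | M.map a ≠ 0}

/-- Two vertices are adjacent in the underlying graph of the subquiver with arrow set
`SA` if some arrow of `SA` joins them (in either direction). -/
def AdjIn (Q : FinQuiver) (SA : Set Q.A) (v w : Q.V) : Prop :=
  ∃ a ∈ SA, (Q.s a = v ∧ Q.t a = w) ∨ (Q.s a = w ∧ Q.t a = v)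

/-- The subquiver with vertex set `SV` and arrow set `SA` is connected: any two of its
vertices are joined by a walk using its arrows. -/
def ConnectedOn (Q : FinQuiver) (SV : Set Q.V) (SA : Set Q.A) : Prop :=
  ∀ v ∈ SV, ∀ w ∈ SV, Relation.ReflTransGen (AdjIn Q SA) v w

/-- The underlying graph of the subquiver with arrow set `SA` contains a cycle:
there are pairwise distinct arrows `e 0, …, e n` in `SA` and pairwise distinct
vertices `v 0, …, v n` such that `e i` joins `v i` and `v (i+1)` (cyclically,
in either direction). -/
def HasCycle (Q : FinQuiver) (SA : Set Q.A) : Prop :=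
  ∃ (n : ℕ) (e : Fin (n + 1) → Q.A) (v : Fin (n + 1) → Q.V),
    Function.Injective e ∧ (∀ i, e i ∈ SA) ∧ Function.Injective v ∧
    ∀ i : Fin (n + 1), (Q.s (e i) = v i ∧ Q.t (e i) = v (i + 1)) ∨
      (Q.s (e i) = v (i + 1) ∧ Q.t (e i) = v i)

/-- The underlying graph of the subquiver `(SV, SA)` is a tree:
nonempty, connected and with no cycles. -/
def IsTreeOn (Q : FinQuiver) (SV : Set Q.V) (SA : Set Q.A) : Prop :=
  SV.Nonempty ∧ ConnectedOn Q SV SA ∧ ¬ HasCycle Q SA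

/-- The underlying graph of the subquiver `(SV, SA)` is a cycle on `n + 1 ≥ 2` vertices. -/
def IsCycleOn (Q : FinQuiver) (SV : Set Q.V) (SA : Set Q.A) : Prop :=
  ∃ n : ℕ, 0 < n ∧ ∃ (ev : Fin (n + 1) → Q.V) (ea : Fin (n + 1) → Q.A),
    Function.Injective ev ∧ Function.Injective ea ∧
    SV = Set.range ev ∧ SA = Set.range ea ∧
    ∀ i : Fin (n + 1), (Q.s (ea i) = ev i ∧ Q.t (ea i) = ev (i + 1)) ∨
      (Q.s (ea i) = ev (i + 1) ∧ Q.t (ea i) = ev i)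

/-- The canonical representation of the subquiver `(SV, SA)`: the field `K` at the
vertices of `SV`, zero elsewhere, identity maps on the arrows of `SA` (realised as
submodules of `K` and inclusions), zero maps elsewhere. -/
noncomputable def canonical (K : Type) [Field K] (Q : FinQuiver)
    (SV : Set Q.V) (SA : Set Q.A) : Rep K Q where
  space v := ↥(if v ∈ SV then (⊤ : Submodule K K) else ⊥)
  map a :=
    if a ∈ SA then
      (if h : (if Q.s a ∈ SV then (⊤ : Submodule K K) else ⊥) ≤
          (if Q.t a ∈ SV then (⊤ : Submodule K K) else ⊥)
        then Submodule.inclusion h else 0)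
    else 0

/-- The simple representation `S(i)`. -/
noncomputable def simple (K : Type) [Field K] (Q : FinQuiver) (i : Q.V) : Rep K Q :=
  canonical K Q {i} ∅

/-- A family of submodules of the vertex spaces of `M` is a subrepresentation if it is
closed under the structure maps. -/
def IsSubRep (M : Rep K Q) (p : ∀ v, Submodule K (M.space v)) : Prop :=
  ∀ a : Q.A, ∀ x ∈ p (Q.s a), M.map a x ∈ p (Q.t a)

/-- The representation carried by a subrepresentation of `M`. -/
noncomputable def restrictRep (M : Rep K Q) (p : ∀ v, Submodule K (M.space v)) : Rep K Q where
  space v := ↥(p v)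
  map a :=
    if h : ∀ x ∈ p (Q.s a), M.map a x ∈ p (Q.t a) then (M.map a).restrict h else 0

/-- The quotient representation `M / p`. -/
noncomputable def quotRep (M : Rep K Q) (p : ∀ v, Submodule K (M.space v)) : Rep K Q where
  space v := M.space v ⧸ p v
  map a :=
    if h : p (Q.s a) ≤ (p (Q.t a)).comap (M.map a) then
      Submodule.mapQ (p (Q.s a)) (p (Q.t a)) (M.map a) h
    else 0

/-- A length function on the category of finite-dimensional `K`-representations of `Q`:
nonnegative real valued, zero exactly on the zero representations, and additive on
short exact sequences. -/
def LengthFunction (l : Rep K Q → ℝ) : Prop :=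
  (∀ X, 0 ≤ l X) ∧ (∀ X, l X = 0 ↔ IsZeroRep X) ∧
    ∀ (X Y Z : Rep K Q) (f : Hom X Y) (g : Hom Y Z),
      (∀ v, Function.Injective (f.app v)) →
      (∀ v, Function.Surjective (g.app v)) →
      (∀ v, LinearMap.range (f.app v) = LinearMap.ker (g.app v)) →
      l Y = l X + l Z


/-- The lexicographic order on finite chains (= finite subsets) of `ℝ`:
`X ≤ₗ Y` iff `min (Y \ X) ≤ min (X \ Y)`, with the convention `min ∅ = ∞`. -/
def RLexLE (X Y : Finset ℝ) : Prop := (Y \ X).min ≤ (X \ Y).min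

/-- `p` is an indecomposable subrepresentation of `M`. -/
def IndecSub (M : Rep K Q) (p : ∀ v, Submodule K (M.space v)) : Prop :=
  IsSubRep M p ∧ Indecomposable (restrictRep M p)

/-- `C` is a finite chain of indecomposable subrepresentations of `M`. -/
def IndecChain (M : Rep K Q) (C : Finset (∀ v, Submodule K (M.space v))) : Prop :=
  (∀ p ∈ C, IndecSub M p) ∧ ∀ p ∈ C, ∀ q ∈ C, p ≤ q ∨ q ≤ p

/-- The values of the length function `l` on the members of a chain of
subrepresentations of `M`. -/
noncomputable def chainL (l : Rep K Q → ℝ) (M : Rep K Q)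
    (C : Finset (∀ v, Submodule K (M.space v))) : Finset ℝ :=
  C.image fun p => l (restrictRep M p)

/-- An indecomposable filtration of `M`: a chain of indecomposable subrepresentations,
starting at a minimal (i.e. simple) one, each a direct predecessor of the next in the
poset of indecomposable subrepresentations, and ending at `M` itself. -/
def IndecFiltration (M : Rep K Q) {m : ℕ}
    (𝒩 : Fin (m + 1) → ∀ v, Submodule K (M.space v)) : Prop :=
  (∀ i, IndecSub M (𝒩 i)) ∧
  (∀ r, IndecSub M r → r ≤ 𝒩 0 → r = 𝒩 0) ∧
  (∀ i : Fin m, 𝒩 i.castSucc ≤ 𝒩 i.succ ∧ 𝒩 i.castSucc ≠ 𝒩 i.succ ∧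
    ∀ r, IndecSub M r → 𝒩 i.castSucc ≤ r → r ≤ 𝒩 i.succ →
      r = 𝒩 i.castSucc ∨ r = 𝒩 i.succ) ∧
  𝒩 (Fin.last m) = fun _ => ⊤

/-- `Z` is the Gabriel-Roiter measure `μ_l(M)`: the lexicographically greatest element of
the set of `l`-values of finite chains of indecomposable subrepresentations of `M`
with maximum `M`. -/
def IsGRMeasure (l : Rep K Q → ℝ) (M : Rep K Q) (Z : Finset ℝ) : Prop :=
  (∃ C, IndecChain M C ∧ (fun _ => (⊤ : Submodule K _)) ∈ C ∧ chainL l M C = Z) ∧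
  ∀ C, IndecChain M C → (fun _ => (⊤ : Submodule K _)) ∈ C → RLexLE (chainL l M C) Z

/-- `𝒩` is a GR filtration of `M` with respect to `l`: an indecomposable filtration
whose chain of `l`-values attains the Gabriel-Roiter measure of `M`. -/
def IsGRFiltration (l : Rep K Q → ℝ) (M : Rep K Q) {m : ℕ}
    (𝒩 : Fin (m + 1) → ∀ v, Submodule K (M.space v)) : Prop :=
  IndecFiltration M 𝒩 ∧
    ∀ C, IndecChain M C → (fun _ => (⊤ : Submodule K _)) ∈ C →
      RLexLE (chainL l M C) (chainL l M (Finset.image 𝒩 Finset.univ))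

/-- `(SV, SA)` is a subquiver of `Q`: arrows of `SA` have their endpoints in `SV`. -/
def IsSubquiver (Q : FinQuiver) (P : Set Q.V × Set Q.A) : Prop :=
  ∀ a ∈ P.2, Q.s a ∈ P.1 ∧ Q.t a ∈ P.1

/-- `P` is a member of `ℒ(Q)`, the poset of connected nonempty subquivers of `Q`. -/
def InL (Q : FinQuiver) (P : Set Q.V × Set Q.A) : Prop :=
  IsSubquiver Q P ∧ P.1.Nonempty ∧ ConnectedOn Q P.1 P.2

/-- The order `≤_C` on subquivers: `P` is a subquiver of `P'` and every arrow of `P'`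
whose source lies in `P` also has its target in `P`. -/
def leC (Q : FinQuiver) (P P' : Set Q.V × Set Q.A) : Prop :=
  P.1 ⊆ P'.1 ∧ P.2 ⊆ P'.2 ∧ ∀ a ∈ P'.2, Q.s a ∈ P.1 → Q.t a ∈ P.1

/-- The total weight of the vertices of a subquiver. -/
noncomputable def qweight (w : Q.V → ℝ) (P : Set Q.V × Set Q.A) : ℝ :=
  ∑ v : Q.V, if v ∈ P.1 then w v else 0

/-- `C` is a finite chain in the poset `ℒ(Q)`. -/
def LChain (Q : FinQuiver) (C : Finset (Set Q.V × Set Q.A)) : Prop :=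
  (∀ P ∈ C, InL Q P) ∧ ∀ P ∈ C, ∀ P' ∈ C, leC Q P P' ∨ leC Q P' P

/-- The weights of the members of a chain of subquivers. -/
noncomputable def qchainW (w : Q.V → ℝ) (C : Finset (Set Q.V × Set Q.A)) : Finset ℝ :=
  C.image (qweight w)

/-- A filtration in the poset `ℒ(Q)`: starting at a minimal connected subquiver, each
member a direct predecessor of the next one. -/
def LFiltration (Q : FinQuiver) {m : ℕ} (𝒬 : Fin (m + 1) → Set Q.V × Set Q.A) : Prop :=
  (∀ i, InL Q (𝒬 i)) ∧
  (∀ P, InL Q P → leC Q P (𝒬 0) → P = 𝒬 0) ∧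
  ∀ i : Fin m, leC Q (𝒬 i.castSucc) (𝒬 i.succ) ∧ 𝒬 i.castSucc ≠ 𝒬 i.succ ∧
    ∀ P, InL Q P → leC Q (𝒬 i.castSucc) P → leC Q P (𝒬 i.succ) →
      P = 𝒬 i.castSucc ∨ P = 𝒬 i.succ

/-- `Z` is the value `w*(P₀)` of the induced chain length function of the weight
function `w` in the poset `ℒ(Q)`. -/
def IsWStar (Q : FinQuiver) (w : Q.V → ℝ) (P₀ : Set Q.V × Set Q.A) (Z : Finset ℝ) : Prop :=
  (∃ C, LChain Q C ∧ (P₀ ∈ C ∧ ∀ P ∈ C, leC Q P P₀) ∧ qchainW w C = Z) ∧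
  ∀ C, LChain Q C → (P₀ ∈ C ∧ ∀ P ∈ C, leC Q P P₀) → RLexLE (qchainW w C) Z

/-- `𝒬` is a `w*`-filtration of `P₀` in the poset `ℒ(Q)`. -/
def IsWStarLFiltration (Q : FinQuiver) (w : Q.V → ℝ) {m : ℕ}
    (𝒬 : Fin (m + 1) → Set Q.V × Set Q.A) (P₀ : Set Q.V × Set Q.A) : Prop :=
  LFiltration Q 𝒬 ∧ 𝒬 (Fin.last m) = P₀ ∧
    ∀ C, LChain Q C → (P₀ ∈ C ∧ ∀ P ∈ C, leC Q P P₀) →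
      RLexLE (qchainW w C) (qchainW w (Finset.image 𝒬 Finset.univ))

/-- `E` is an injective object in the category of finite-dimensional
`K`-representations of `Q`. -/
def InjectiveRep (E : Rep K Q) : Prop :=
  ∀ (X Y : Rep K Q) (f : Hom X Y), (∀ v, Function.Injective (f.app v)) →
    ∀ g : Hom X E, ∃ h : Hom Y E, Hom.comp h f = g

end QR

namespace QR

/-- The underlying simple graph of the subquiver of `Q` with arrow set `S`. -/
def arrowGraph (Q : FinQuiver) (S : Set Q.A) : SimpleGraph Q.V :=
  SimpleGraph.fromRel fun v w => ∃ a ∈ S, Q.s a = v ∧ Q.t a = w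

theorem adjIn_of_arrowGraph_adj {Q : FinQuiver} {S : Set Q.A} {v w : Q.V}
    (h : (arrowGraph Q S).Adj v w) : AdjIn Q S v w := by
  obtain ⟨-, ⟨a, ha, h⟩ | ⟨a, ha, h⟩⟩ := (SimpleGraph.fromRel_adj _ _ _).1 h
  · exact ⟨a, ha, Or.inl h⟩
  · exact ⟨a, ha, Or.inr h⟩

theorem arrowGraph_reachable {Q : FinQuiver} {S : Set Q.A} {a : Q.A} (ha : a ∈ S) :
    (arrowGraph Q S).Reachable (Q.s a) (Q.t a) := by
  by_cases h : Q.s a = Q.t a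
  · rw [h]
  · exact SimpleGraph.Adj.reachable
      ((SimpleGraph.fromRel_adj _ _ _).2 ⟨h, Or.inl ⟨a, ha, rfl, rfl⟩⟩)

theorem HasCycle.mono {Q : FinQuiver} {S T : Set Q.A} (h : S ⊆ T) (hS : HasCycle Q S) :
    HasCycle Q T := by
  obtain ⟨n, e, v, he, heS, hv, hj⟩ := hS
  exact ⟨n, e, v, he, fun i => h (heS i), hv, hj⟩

/-- Adding an arrow between two vertices that are already joined creates a cycle. -/
theorem hasCycle_insert {Q : FinQuiver} {S : Set Q.A} {a : Q.A} (ha : a ∉ S)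
    (h : (arrowGraph Q S).Reachable (Q.t a) (Q.s a)) : HasCycle Q (insert a S) := by
  obtain ⟨p, hp⟩ := h.exists_isPath
  have hinj := hp.getVert_injOn
  have hadj : ∀ i, i < p.length → AdjIn Q S (p.getVert i) (p.getVert (i + 1)) :=
    fun i hi => adjIn_of_arrowGraph_adj (p.adj_getVert_succ hi)
  have : Nonempty Q.A := ⟨a⟩
  choose! e heS hej using hadj
  have hij : ∀ i j, i ≤ p.length → j ≤ p.length → p.getVert i = p.getVert j → i = j :=
    fun i j hi hj hh => hinj hi hj hh
  refine ⟨p.length, fun i => if i.1 < p.length then e i else a, fun i => p.getVert i,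
    ?_, ?_, ?_, ?_⟩
  · intro i j hh
    have hi := i.2
    have hj := j.2
    ext
    by_cases h1 : i.1 < p.length <;> by_cases h2 : j.1 < p.length <;>
      simp only [h1, h2, if_true, if_false] at hh
    · have ei := hej i h1
      have ej := hej j h2
      rw [hh] at ei
      have k1 := hij i j (by omega) (by omega)
      have k2 := hij i (j + 1) (by omega) (by omega)
      have k3 := hij (i + 1) j (by omega) (by omega)
      grind
    · exact absurd (hh ▸ heS i h1) ha
    · exact absurd (hh ▸ heS j h2) ha
    · omega
  · intro i
    dsimp only
    split_ifs with h1
    · exact Or.inr (heS i h1)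
    · exact Or.inl rfl
  · intro i j hh
    exact Fin.ext (hij i j (by omega) (by omega) hh)
  · intro i
    dsimp only
    split_ifs with h1
    · rw [Fin.val_add_one_of_lt (Fin.lt_def.2 (by simpa using h1))]
      exact hej i h1
    · have hi : i = Fin.last p.length := Fin.ext (by simp; omega)
      subst hi
      simp

/-- Every arrow weighting of a forest with values in a group is a coboundary. -/
theorem exists_potential {G : Type*} [Group G] {Q : FinQuiver} (c : Q.A → G) (S : Finset Q.A)
    (hS : ¬ HasCycle Q (S : Set Q.A)) :
    ∃ g : Q.V → G, ∀ a ∈ S, g (Q.s a) = g (Q.t a) * c a := by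
  induction S using Finset.induction_on with
  | empty => exact ⟨fun _ => 1, by simp⟩
  | insert a S ha ih =>
    rw [Finset.coe_insert] at hS
    obtain ⟨g, hg⟩ := ih fun h => hS (h.mono (Set.subset_insert _ _))
    have hr : ¬ (arrowGraph Q (S : Set Q.A)).Reachable (Q.t a) (Q.s a) :=
      fun h => hS (hasCycle_insert (by simpa using ha) h)
    let d : G := g (Q.s a) * (c a)⁻¹ * (g (Q.t a))⁻¹
    refine ⟨fun v => if (arrowGraph Q (S : Set Q.A)).Reachable (Q.t a) v then d * g v else g v,
      fun b hb => ?_⟩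
    rcases Finset.mem_insert.1 hb with rfl | hb
    · simp [hr, d]
    · have hb' := arrowGraph_reachable (Q := Q) (S := (S : Set Q.A)) (by simpa using hb)
      have hiff : (arrowGraph Q (S : Set Q.A)).Reachable (Q.t a) (Q.s b) ↔
          (arrowGraph Q (S : Set Q.A)).Reachable (Q.t a) (Q.t b) :=
        ⟨fun h => h.trans hb', fun h => h.trans hb'.symm⟩
      simp only [hiff]
      split_ifs
      · rw [hg b hb, ← mul_assoc d]
      · exact hg b hb

variable {K : Type} [Field K] {Q : FinQuiver}

theorem source_mem_suppV {N : Rep K Q} {a : Q.A} (ha : a ∈ suppA N) : Q.s a ∈ suppV N := by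
  by_contra h
  refine ha (LinearMap.ext fun x => ?_)
  have hx : x = 0 := by
    by_contra hx
    exact h ⟨x, hx⟩
  simp [hx]

theorem target_mem_suppV {N : Rep K Q} {a : Q.A} (ha : a ∈ suppA N) : Q.t a ∈ suppV N := by
  by_contra h
  refine ha (LinearMap.ext fun x => ?_)
  by_contra hx
  exact h ⟨_, hx⟩

/-- The vertex spaces of a thin representation are those of the canonical one. -/
theorem Rep.Thin.nonempty_equiv {N : Rep K Q} (hN : N.Thin) (v : Q.V) :
    Nonempty (N.space v ≃ₗ[K] (canonical K Q (suppV N) (suppA N)).space v) := by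
  refine ⟨LinearEquiv.ofFinrankEq _ _ ?_⟩
  by_cases h : v ∈ suppV N
  · refine Eq.trans ?_ (congrArg (fun p : Submodule K K => Module.finrank K p) (if_pos h)).symm
    obtain ⟨x, hx⟩ := h
    have : Nontrivial (N.space v) := ⟨x, 0, hx⟩
    have := Module.finrank_pos (R := K) (M := N.space v)
    have := hN v
    rw [finrank_top, Module.finrank_self]
    omega
  · refine Eq.trans ?_ (congrArg (fun p : Submodule K K => Module.finrank K p) (if_neg h)).symm
    have : Subsingleton (N.space v) := by
      refine subsingleton_of_forall_eq 0 fun x => ?_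
      by_contra hx
      exact h ⟨x, hx⟩
    rw [finrank_bot, Module.finrank_zero_of_subsingleton]

/-- The vertex spaces of the canonical representation, seen inside `K`. -/
noncomputable def canonicalVal (SV : Set Q.V) (SA : Set Q.A) (v : Q.V) :
    (canonical K Q SV SA).space v →ₗ[K] K :=
  Submodule.subtype (if v ∈ SV then (⊤ : Submodule K K) else ⊥)

theorem canonicalVal_injective (SV : Set Q.V) (SA : Set Q.A) (v : Q.V) :
    Function.Injective (canonicalVal (K := K) SV SA v) :=
  Subtype.val_injective

theorem canonicalVal_surjective {SV : Set Q.V} (SA : Set Q.A) {v : Q.V} (hv : v ∈ SV) :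
    Function.Surjective (canonicalVal (K := K) SV SA v) :=
  fun k => ⟨⟨k, by simp [hv]⟩, rfl⟩

theorem canonicalVal_map {SV : Set Q.V} {SA : Set Q.A} {a : Q.A} (ha : a ∈ SA)
    (ht : Q.t a ∈ SV) (x : (canonical K Q SV SA).space (Q.s a)) :
    canonicalVal SV SA (Q.t a) ((canonical K Q SV SA).map a x) =
      canonicalVal SV SA (Q.s a) x := by
  have h : (if Q.s a ∈ SV then (⊤ : Submodule K K) else ⊥) ≤
      (if Q.t a ∈ SV then (⊤ : Submodule K K) else ⊥) := by
    rw [if_pos ht]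
    exact le_top
  have hm : (canonical K Q SV SA).map a = Submodule.inclusion h :=
    (if_pos ha).trans (dif_pos h)
  rw [hm]
  rfl

theorem canonical_map_of_notMem {SV : Set Q.V} {SA : Set Q.A} {a : Q.A} (ha : a ∉ SA) :
    (canonical K Q SV SA).map a = 0 :=
  if_neg ha

/-- A linear map out of a line, read in coordinates, is multiplication by a scalar. -/
theorem exists_unit_mul {M M' : Type*} [AddCommGroup M] [Module K M] [AddCommGroup M']
    [Module K M'] {f : M →ₗ[K] M'} (hf : f ≠ 0) {p : M →ₗ[K] K} (hp : Function.Bijective p)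
    {q : M' →ₗ[K] K} (hq : Function.Injective q) :
    ∃ c : Kˣ, ∀ x, q (f x) = c * p x := by
  obtain ⟨u, hu⟩ := hp.2 1
  have hx : ∀ x, x = p x • u := fun x => hp.1 (by simp [hu])
  have hc : ∀ x, q (f x) = q (f u) * p x := fun x => by
    conv_lhs => rw [hx x]
    simp [mul_comm]
  have h0 : q (f u) ≠ 0 := fun h => hf <| LinearMap.ext fun x => hq (by rw [hc x, h]; simp)
  exact ⟨Units.mk0 _ h0, hc⟩

end QR

theorem stmt8 (K : Type) [Field K] (Q : QR.FinQuiver) (hQ : Q.Acyclic)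
    (N : QR.Rep K Q) (hN : N.Thin)
    (hconn : QR.ConnectedOn Q (QR.suppV N) (QR.suppA N))
    (hnocyc : ¬ QR.HasCycle Q (QR.suppA N)) :
    QR.Iso N (QR.canonical K Q (QR.suppV N) (QR.suppA N)) := by
  have φ := fun v => (hN.nonempty_equiv v).some
  let p : ∀ v, N.space v →ₗ[K] K := fun v =>
    (QR.canonicalVal (QR.suppV N) (QR.suppA N) v).comp (φ v).toLinearMap
  have hinj : ∀ v, Function.Injective (p v) := fun v =>
    (QR.canonicalVal_injective _ _ v).comp (φ v).injective
  have hsurj : ∀ v ∈ QR.suppV N, Function.Surjective (p v) := fun v hv =>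
    (QR.canonicalVal_surjective _ hv).comp (φ v).surjective
  have hc : ∀ a ∈ QR.suppA N, ∃ c : Kˣ, ∀ x, p (Q.t a) (N.map a x) = c * p (Q.s a) x :=
    fun a ha => QR.exists_unit_mul ha
      ⟨hinj _, hsurj _ (QR.source_mem_suppV ha)⟩ (hinj _)
  choose! c hc using hc
  obtain ⟨g, hg⟩ := QR.exists_potential c (QR.suppA N).toFinset (by simpa using hnocyc)
  refine ⟨⟨fun v => (g v : K) • (φ v).toLinearMap, fun a => ?_⟩, fun v => ?_⟩
  · by_cases ha : a ∈ QR.suppA N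
    · refine LinearMap.ext fun x => QR.canonicalVal_injective _ _ _ ?_
      have h := hc a ha x
      simp only [p, LinearMap.comp_apply, LinearEquiv.coe_coe] at h
      simp only [LinearMap.comp_apply, LinearMap.smul_apply, map_smul, LinearEquiv.coe_coe,
        QR.canonicalVal_map ha (QR.target_mem_suppV ha), h, hg a (by simpa using ha)]
      simp [mul_assoc]
    · have h0 : N.map a = 0 := not_not.1 ha
      simp [QR.canonical_map_of_notMem ha, h0]
  · exact (LinearEquiv.smulOfNeZero K _ (g v : K) (g v).ne_zero).bijective.comp (φ v).bijective
end

section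
/- Let Q be a finite acyclic quiver whose underlying graph is a cycle (type Ã_n), K a field, and M a thin representation of Q with supp(M) = Q. Let N be a maximal element of the poset of proper indecomposable subrepresentations of M. Then the quotient M/N is isomorphic to the simple representation S(i) for a vertex i that is a source of Q (both arrows incident to i start at i), and this S(i) is an injective object in the category of finite-dimensional K-representations of Q. -/
open scoped Classical

namespace QR

variable {K : Type} [Field K] {Q : FinQuiver}

lemma restrictRep_map_coe {M : Rep K Q} {q : ∀ v, Submodule K (M.space v)} (h : IsSubRep M q)
    (a : Q.A) (x : q (Q.s a)) :
    (show q (Q.t a) from (restrictRep M q).map a x : M.space (Q.t a)) = M.map a (x : M.space _) := by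
  simp only [restrictRep]
  rw [dif_pos (h a)]
  rfl

lemma Rep.Thin.exists_smul_eq {M : Rep K Q} (hM : M.Thin) {v : Q.V} {x : M.space v} (hx : x ≠ 0)
    (y : M.space v) : ∃ c : K, c • x = y := by
  obtain ⟨u, hu⟩ := finrank_le_one_iff.1 (hM v)
  obtain ⟨c, rfl⟩ := hu x
  obtain ⟨d, rfl⟩ := hu y
  have hc : c ≠ 0 := by rintro rfl; simp at hx
  exact ⟨d * c⁻¹, by rw [smul_smul, mul_assoc, inv_mul_cancel₀ hc, mul_one]⟩

lemma Rep.Thin.eq_top_of_ne_bot {M : Rep K Q} (hM : M.Thin) {v : Q.V}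
    {q : Submodule K (M.space v)} (hq : q ≠ ⊥) : q = ⊤ := by
  obtain ⟨x, hxq, hx⟩ := Submodule.exists_mem_ne_zero_of_ne_bot hq
  refine eq_top_iff.2 fun y _ => ?_
  obtain ⟨c, rfl⟩ := hM.exists_smul_eq hx y
  exact q.smul_mem c hxq

lemma Rep.Thin.restrictRep {M : Rep K Q} (hM : M.Thin) (q : ∀ v, Submodule K (M.space v)) :
    (restrictRep M q).Thin :=
  fun v => (Submodule.finrank_le (q v)).trans (hM v)

lemma Rep.Thin.map_injective {M : Rep K Q} (hM : M.Thin) {a : Q.A} (ha : M.map a ≠ 0) :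
    Function.Injective (M.map a) := by
  refine (injective_iff_map_eq_zero _).2 fun x hx => ?_
  by_contra hx0
  refine ha (LinearMap.ext fun y => ?_)
  obtain ⟨c, rfl⟩ := hM.exists_smul_eq hx0 y
  simp [hx]

/-- A set of vertices is separated in `R` if no nonzero structure map of `R` enters or
leaves it. -/
def Rep.Separated (R : Rep K Q) (T : Set Q.V) : Prop :=
  ∀ a : Q.A, R.map a ≠ 0 → (Q.s a ∈ T ↔ Q.t a ∈ T)

lemma Rep.Separated.compl {R : Rep K Q} {T : Set Q.V} (hT : R.Separated T) : R.Separated Tᶜ :=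
  fun a ha => not_congr (hT a ha)

/-- The part of `R` living on the vertices of `T`. -/
noncomputable def Rep.part (R : Rep K Q) (T : Set Q.V) : ∀ v, Submodule K (R.space v) :=
  fun v => if v ∈ T then ⊤ else ⊥

lemma Rep.eq_zero_of_mem_part {R : Rep K Q} {T : Set Q.V} {v : Q.V} (hv : v ∉ T)
    {x : R.space v} (hx : x ∈ R.part T v) : x = 0 := by
  simpa [Rep.part, hv] using hx

lemma Rep.Separated.isSubRep_part {R : Rep K Q} {T : Set Q.V} (hT : R.Separated T) :
    IsSubRep R (R.part T) := by
  intro a x hx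
  by_cases ha : R.map a = 0
  · simp [ha]
  · by_cases hs : Q.s a ∈ T
    · simp [Rep.part, (hT a ha).1 hs]
    · simp [Rep.eq_zero_of_mem_part hs hx]

/-- The projection of a representation onto its part living on the vertices of `T`. -/
noncomputable def Rep.Separated.proj {R : Rep K Q} {T : Set Q.V} (hT : R.Separated T) :
    Hom R (restrictRep R (R.part T)) where
  app v := LinearMap.codRestrict (R.part T v)
    (if v ∈ T then LinearMap.id else 0) (by
      intro x
      by_cases hv : v ∈ T <;> simp [Rep.part, hv])
  comm a := by
    ext x
    refine Subtype.ext ?_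
    refine (restrictRep_map_coe hT.isSubRep_part a _).trans ?_
    change R.map a ((if Q.s a ∈ T then LinearMap.id else 0 : R.space _ →ₗ[K] R.space _) x) =
      (if Q.t a ∈ T then LinearMap.id else 0 : R.space _ →ₗ[K] R.space _) (R.map a x)
    by_cases ha : R.map a = 0
    · simp [ha]
    · by_cases hs : Q.s a ∈ T
      · simp [hs, (hT a ha).1 hs]
      · simp [hs, mt (hT a ha).2 hs]

lemma Rep.Separated.proj_coe {R : Rep K Q} {T : Set Q.V} (hT : R.Separated T) (v : Q.V)
    (x : R.space v) :
    (show R.part T v from hT.proj.app v x : R.space v) = if v ∈ T then x else 0 := by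
  change (if v ∈ T then LinearMap.id else 0 : R.space v →ₗ[K] R.space v) x = _
  by_cases hv : v ∈ T <;> simp [hv]

/-- The support of an indecomposable representation lies on one side of every separated set. -/
lemma Indecomposable.subset_or_disjoint {R : Rep K Q} (hR : Indecomposable R) {T : Set Q.V}
    (hT : R.Separated T) : suppV R ⊆ T ∨ Disjoint (suppV R) T := by
  by_contra! hcon
  obtain ⟨h1, h2⟩ := hcon
  obtain ⟨v, ⟨x, hx⟩, hv⟩ := Set.not_subset.1 h1
  obtain ⟨w, ⟨y, hy⟩, hw⟩ := Set.not_disjoint_iff.1 h2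
  refine hR.2 ⟨restrictRep R (R.part T), restrictRep R (R.part Tᶜ),
    ⟨w, hT.proj.app w y, fun h => hy ?_⟩, ⟨v, hT.compl.proj.app v x, fun h => hx ?_⟩, ?_⟩
  · exact ((hT.proj_coe w y).trans (if_pos hw)).symm.trans
      (congrArg (Subtype.val : R.part T w → _) h)
  · exact ((hT.compl.proj_coe v x).trans (if_pos hv)).symm.trans
      (congrArg (Subtype.val : R.part Tᶜ v → _) h)
  · refine ⟨⟨fun u => (hT.proj.app u).prod (hT.compl.proj.app u), fun a => ?_⟩, fun u => ⟨?_, ?_⟩⟩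
    · refine LinearMap.ext fun z => Prod.ext ?_ ?_
      · exact LinearMap.congr_fun (hT.proj.comm a) z
      · exact LinearMap.congr_fun (hT.compl.proj.comm a) z
    · refine (injective_iff_map_eq_zero _).2 fun z hz => ?_
      have e1 := congrArg (Subtype.val : R.part T u → _) (congrArg Prod.fst hz)
      have e2 := congrArg (Subtype.val : R.part Tᶜ u → _) (congrArg Prod.snd hz)
      replace e1 := (hT.proj_coe u z).symm.trans e1
      replace e2 := (hT.compl.proj_coe u z).symm.trans e2
      by_cases hu : u ∈ T
      · rw [if_pos hu] at e1
        exact e1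
      · rw [if_pos (show u ∈ Tᶜ from hu)] at e2
        exact e2
    · rintro ⟨⟨z, hz⟩, ⟨z', hz'⟩⟩
      refine ⟨z + z', Prod.ext (Subtype.ext ?_) (Subtype.ext ?_)⟩
      · refine (hT.proj_coe u _).trans ?_
        by_cases hu : u ∈ T
        · simp [hu, Rep.eq_zero_of_mem_part (not_not.2 hu) hz']
        · simp [hu, Rep.eq_zero_of_mem_part hu hz]
      · refine (hT.compl.proj_coe u _).trans ?_
        by_cases hu : u ∈ T
        · simp [hu, Rep.eq_zero_of_mem_part (not_not.2 hu) hz']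
        · simp [hu, Rep.eq_zero_of_mem_part hu hz]

/-- A nonzero thin representation without nontrivial separated sets is indecomposable. -/
lemma Rep.Thin.indecomposable {R : Rep K Q} (hthin : R.Thin) (hR : R.Nonzero)
    (h : ∀ T, R.Separated T → suppV R ⊆ T ∨ Disjoint (suppV R) T) : Indecomposable R := by
  refine ⟨hR, ?_⟩
  rintro ⟨N, N', ⟨w, y, hy⟩, ⟨w', y', hy'⟩, f, hf⟩
  have hsub : ∀ {v} {x : N.space v} {x' : N'.space v}, x ≠ 0 → x' = 0 := by
    intro v x x' hx
    obtain ⟨u, hu⟩ := (hf v).2 (x, 0)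
    obtain ⟨u', hu'⟩ := (hf v).2 (0, x')
    have hu0 : u ≠ 0 := by
      rintro rfl
      rw [map_zero] at hu
      exact hx (congrArg Prod.fst hu).symm
    obtain ⟨c, rfl⟩ := hthin.exists_smul_eq hu0 u'
    rw [map_smul, hu] at hu'
    exact (congrArg Prod.snd hu').symm.trans (smul_zero c)
  have hcomm : ∀ a (x : R.space (Q.s a)),
      (N.map a (f.app (Q.s a) x).1, N'.map a (f.app (Q.s a) x).2) = f.app (Q.t a) (R.map a x) :=
    fun a x => LinearMap.congr_fun (f.comm a) x
  have hsupp : ∀ {v} {z : N.space v × N'.space v}, z ≠ 0 → v ∈ suppV R := by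
    intro v z hz
    obtain ⟨u, hu⟩ := (hf v).2 z
    exact ⟨u, by rintro rfl; exact hz (hu.symm.trans (map_zero _))⟩
  have hsep : R.Separated (suppV N) := by
    intro a ha
    obtain ⟨x, hx⟩ : ∃ x, R.map a x ≠ 0 := by
      by_contra! hx
      exact ha (LinearMap.ext hx)
    have hne : f.app (Q.t a) (R.map a x) ≠ 0 :=
      fun h0 => hx ((hf _).1 (h0.trans (map_zero _).symm))
    rw [← hcomm] at hne
    constructor
    · rintro ⟨n, hn⟩
      refine ⟨N.map a (f.app (Q.s a) x).1, fun h0 => hne ?_⟩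
      rw [h0, hsub (x' := (f.app (Q.s a) x).2) hn, map_zero]
      rfl
    · rintro ⟨n, hn⟩
      refine ⟨(f.app (Q.s a) x).1, fun h0 => hne ?_⟩
      rw [h0, map_zero, hsub (x' := N'.map a (f.app (Q.s a) x).2) hn]
      rfl
  rcases h _ hsep with h | h
  · obtain ⟨n, hn⟩ := h (hsupp (z := ((0 : N.space w'), y')) (by simpa using hy'))
    exact hy' (hsub hn)
  · exact Set.disjoint_left.1 h (hsupp (z := (y, (0 : N'.space w))) (by simpa using hy)) ⟨y, hy⟩

lemma mem_suppV_restrictRep {M : Rep K Q} {q : ∀ v, Submodule K (M.space v)} {v : Q.V} :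
    v ∈ suppV (restrictRep M q) ↔ q v ≠ ⊥ := by
  rw [Submodule.ne_bot_iff]
  constructor
  · rintro ⟨⟨x, hx⟩, h0⟩
    exact ⟨x, hx, fun h => h0 (Subtype.ext h)⟩
  · rintro ⟨x, hx, h0⟩
    exact ⟨⟨x, hx⟩, fun h => h0 (congrArg (Subtype.val : q v → _) h)⟩

lemma restrictRep_map_ne_zero {M : Rep K Q} {q : ∀ v, Submodule K (M.space v)}
    (hq : IsSubRep M q) {a : Q.A} (ha : Function.Injective (M.map a)) :
    (restrictRep M q).map a ≠ 0 ↔ q (Q.s a) ≠ ⊥ := by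
  rw [Submodule.ne_bot_iff]
  constructor
  · intro h
    by_contra! hbot
    refine h (LinearMap.ext fun x => Subtype.ext ?_)
    refine (restrictRep_map_coe hq a x).trans ?_
    rw [hbot _ x.2, map_zero]
    rfl
  · rintro ⟨x, hx, h0⟩ h
    refine h0 (ha ?_)
    rw [map_zero, ← restrictRep_map_coe hq a ⟨x, hx⟩, h]
    rfl

lemma finrank_simple_self (i : Q.V) : Module.finrank K ((simple K Q i).space i) = 1 := by
  change Module.finrank K ↥(if i ∈ ({i} : Set Q.V) then (⊤ : Submodule K K) else ⊥) = 1
  rw [if_pos (Set.mem_singleton i), finrank_top, Module.finrank_self]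

lemma subsingleton_simple {i v : Q.V} (h : v ≠ i) : Subsingleton ((simple K Q i).space v) := by
  change Subsingleton ↥(if v ∈ ({i} : Set Q.V) then (⊤ : Submodule K K) else ⊥)
  rw [if_neg (Set.mem_singleton_iff.not.2 h)]
  infer_instance

/-- The simple representation at a source is injective. -/
lemma injectiveRep_simple_of_source {i : Q.V} (hi : ∀ a : Q.A, Q.t a ≠ i) :
    InjectiveRep (simple K Q i) := by
  intro X Y f hf g
  choose l hl using fun v =>
    LinearMap.exists_leftInverse_of_injective (f.app v) (LinearMap.ker_eq_bot.2 (hf v))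
  refine ⟨⟨fun v => (g.app v).comp (l v), fun a => ?_⟩, ?_⟩
  · have := subsingleton_simple (K := K) (hi a)
    exact LinearMap.ext fun _ => Subsingleton.elim _ _
  · obtain ⟨g, hg⟩ := g
    simp only [Hom.comp, Hom.mk.injEq]
    funext v
    rw [LinearMap.comp_assoc, hl, LinearMap.comp_id]

/-- If a family of submodules is everything except at a source `i`, where it has codimension
one, then the quotient is the simple representation `S(i)`. -/
lemma iso_quotRep_simple {M : Rep K Q} {p : ∀ v, Submodule K (M.space v)} {i : Q.V}
    (hi : ∀ a : Q.A, Q.t a ≠ i) (hp : ∀ v, v ≠ i → p v = ⊤)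
    (hpi : Module.finrank K (M.space i ⧸ p i) = 1) : Iso (quotRep M p) (simple K Q i) := by
  have hrank : ∀ v, Module.finrank K ((quotRep M p).space v) =
      Module.finrank K ((simple K Q i).space v) := by
    intro v
    by_cases hv : v = i
    · subst hv
      rw [finrank_simple_self]
      exact hpi
    · have := subsingleton_simple (K := K) hv
      have : Subsingleton ((quotRep M p).space v) :=
        Submodule.Quotient.subsingleton_iff.2 (hp v hv)
      rw [Module.finrank_zero_of_subsingleton, Module.finrank_zero_of_subsingleton]
  refine ⟨⟨fun v => (LinearEquiv.ofFinrankEq _ _ (hrank v)).toLinearMap, fun a => ?_⟩,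
    fun v => (LinearEquiv.ofFinrankEq _ _ (hrank v)).bijective⟩
  have := subsingleton_simple (K := K) (hi a)
  exact LinearMap.ext fun _ => Subsingleton.elim _ _

open scoped Fin.CommRing in
/-- In a cycle, let `S` be a nonempty set of vertices avoiding `c` such that every arrow joining
`S` to its complement starts or ends at `c`. Then `S` contains every vertex other than `c`. -/
lemma IsCycleOn.mem_of_ne (hcyc : IsCycleOn Q Set.univ Set.univ) {S : Set Q.V} {c : Q.V}
    (hne : S.Nonempty) (hc : c ∉ S)
    (h : ∀ a : Q.A, Q.s a ≠ c → Q.t a ≠ c → (Q.s a ∈ S ↔ Q.t a ∈ S)) {v : Q.V} (hv : v ≠ c) :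
    v ∈ S := by
  obtain ⟨n, -, ev, ea, hev, -, hV, -, hinc⟩ := hcyc
  have hsurj : ∀ v, ∃ j, ev j = v := fun v => hV.subset (Set.mem_univ v)
  obtain ⟨k, rfl⟩ := hsurj c
  have hstep : ∀ j, j ≠ k → j + 1 ≠ k → (ev j ∈ S ↔ ev (j + 1) ∈ S) := by
    intro j h1 h2
    rcases hinc j with ⟨e1, e2⟩ | ⟨e1, e2⟩
    · have := h (ea j)
      rw [e1, e2] at this
      exact this (hev.ne h1) (hev.ne h2)
    · have := h (ea j)
      rw [e1, e2] at this
      exact (this (hev.ne h2) (hev.ne h1)).symm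
  have hcast : ∀ m : ℕ, 0 < m → m ≤ n → k + (m : Fin (n + 1)) ≠ k := by
    intro m h0 h1 h2
    have := Nat.le_of_dvd h0 ((Fin.natCast_eq_zero).1 (add_eq_left.1 h2))
    omega
  have hall : ∀ m : ℕ, m + 1 ≤ n →
      (ev (k + ((m + 1 : ℕ) : Fin (n + 1))) ∈ S ↔ ev (k + ((1 : ℕ) : Fin (n + 1))) ∈ S) := by
    intro m
    induction m with
    | zero => intro _; rfl
    | succ m ih =>
      intro hm
      rw [← ih (by omega)]
      have h2 := hcast (m + 1 + 1) (by omega) hm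
      have e : k + ((m + 1 + 1 : ℕ) : Fin (n + 1)) = k + ((m + 1 : ℕ) : Fin (n + 1)) + 1 := by
        push_cast; ring
      rw [e] at h2 ⊢
      exact (hstep _ (hcast (m + 1) (by omega) (by omega)) h2).symm
  have hrep : ∀ v, v ≠ ev k → ∃ m : ℕ, m + 1 ≤ n ∧ ev (k + ((m + 1 : ℕ) : Fin (n + 1))) = v := by
    intro v hv
    obtain ⟨j, rfl⟩ := hsurj v
    have hj : (j - k).val ≠ 0 := by
      intro h0
      exact hv (congrArg ev (sub_eq_zero.1 (Fin.ext h0)))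
    refine ⟨(j - k).val - 1, by have := (j - k).isLt; omega, ?_⟩
    rw [Nat.sub_add_cancel (by omega), Fin.cast_val_eq_self, add_sub_cancel]
  obtain ⟨w, hw⟩ := hne
  obtain ⟨m, hm, rfl⟩ := hrep w (by rintro rfl; exact hc hw)
  obtain ⟨m', hm', rfl⟩ := hrep v hv
  exact (hall m' hm').2 ((hall m hm).1 hw)

lemma FinQuiver.Acyclic.eq_of_reflTransGen (hQ : Q.Acyclic) {v w : Q.V}
    (h : Relation.ReflTransGen Q.Step v w) (h' : Relation.ReflTransGen Q.Step w v) : v = w := by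
  rcases Relation.reflTransGen_iff_eq_or_transGen.1 h with e | h
  · exact e.symm
  · exact absurd (h.trans_left h') (hQ v)

/-- A maximal proper indecomposable subrepresentation `p`, together with any vertex `c` outside
its support having an arrow into the support, generates the whole representation: every vertex
outside the support of `p` is reachable from `c`. -/
lemma reflTransGen_of_maximal {M : Rep K Q} (hthin : M.Thin)
    (hsuppV : suppV M = Set.univ) (hsuppA : suppA M = Set.univ)
    {p : ∀ v, Submodule K (M.space v)} (hp : IndecSub M p)
    (hmax : ∀ r, IndecSub M r → r ≠ (fun _ => ⊤) → p ≤ r → r = p)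
    {a : Q.A} (hs : p (Q.s a) = ⊥) (ht : p (Q.t a) ≠ ⊥) {v : Q.V} (hv : p v = ⊥) :
    Relation.ReflTransGen Q.Step (Q.s a) v := by
  have hinj : ∀ b, Function.Injective (M.map b) :=
    fun b => hthin.map_injective (hsuppA ▸ Set.mem_univ b : b ∈ suppA M)
  have htop : ∀ v, (⊤ : Submodule K (M.space v)) ≠ ⊥ := by
    intro v
    obtain ⟨x, hx⟩ : v ∈ suppV M := hsuppV ▸ Set.mem_univ v
    exact fun h => hx ((Submodule.mem_bot K).1 (h ▸ Submodule.mem_top))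
  set U : Set Q.V := {v | p v ≠ ⊥ ∨ Relation.ReflTransGen Q.Step (Q.s a) v} with hU
  have hUne : ∀ v, M.part U v ≠ ⊥ ↔ v ∈ U := by
    intro v
    by_cases h : v ∈ U <;> simp [Rep.part, h, htop]
  have hUs : ∀ b, Q.s b ∈ U → Q.t b ∈ U := by
    rintro b (h | h)
    · exact Or.inl ((Submodule.ne_bot_iff _).2 (by
        obtain ⟨x, hx, h0⟩ := (Submodule.ne_bot_iff _).1 h
        exact ⟨_, hp.1 b x hx, fun h => h0 (hinj b (h.trans (map_zero _).symm))⟩))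
    · exact Or.inr (h.tail ⟨b, rfl, rfl⟩)
  have hsub : IsSubRep M (M.part U) := by
    intro b x hx
    by_cases h : Q.s b ∈ U
    · simp [Rep.part, hUs b h]
    · simp [Rep.eq_zero_of_mem_part h hx]
  have hle : p ≤ M.part U := by
    intro v
    by_cases h : p v = ⊥
    · simp [h]
    · simp [Rep.part, hU, h]
  have hind : Indecomposable (restrictRep M (M.part U)) := by
    refine (hthin.restrictRep _).indecomposable
      ⟨Q.s a, mem_suppV_restrictRep.2 ((hUne _).2 (Or.inr .refl))⟩ fun T hT => ?_
    have hT' : ∀ b, Q.s b ∈ U → (Q.s b ∈ T ↔ Q.t b ∈ T) := fun b hb =>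
      hT b ((restrictRep_map_ne_zero hsub (hinj b)).2 ((hUne _).2 hb))
    have hpT : (restrictRep M p).Separated T := fun b hb =>
      hT' b (Or.inl ((restrictRep_map_ne_zero hp.1 (hinj b)).1 hb))
    have hreach : ∀ v, Relation.ReflTransGen Q.Step (Q.s a) v → (v ∈ T ↔ Q.t a ∈ T) := by
      intro v hv
      induction hv with
      | refl => exact hT' a (Or.inr .refl)
      | tail h1 h2 ih =>
        obtain ⟨b, rfl, rfl⟩ := h2
        exact (hT' b (Or.inr h1)).symm.trans ih
    have hta : Q.t a ∈ suppV (restrictRep M p) := mem_suppV_restrictRep.2 ht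
    refine (hp.2.subset_or_disjoint hpT).imp (fun h v hv => ?_)
      (fun h => Set.disjoint_left.2 fun v hv => ?_)
    · rcases (hUne v).1 (mem_suppV_restrictRep.1 hv) with h1 | h1
      · exact h (mem_suppV_restrictRep.2 h1)
      · exact (hreach v h1).2 (h hta)
    · rcases (hUne v).1 (mem_suppV_restrictRep.1 hv) with h1 | h1
      · exact Set.disjoint_left.1 h (mem_suppV_restrictRep.2 h1)
      · exact fun hvT => Set.disjoint_left.1 h hta ((hreach v h1).1 hvT)
  have hpart : M.part U = fun _ => ⊤ := by
    by_contra h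
    have := hmax _ ⟨hsub, hind⟩ h hle
    exact (hUne (Q.s a)).2 (Or.inr .refl) ((congrFun this _).trans hs)
  have : v ∈ U := (hUne v).1 (by rw [hpart]; exact htop v)
  exact this.resolve_left (not_not.2 hv)

end QR

open QR in
theorem stmt13 (K : Type) [Field K] (Q : FinQuiver) (hQ : Q.Acyclic)
    (hcyc : IsCycleOn Q Set.univ Set.univ)
    (M : Rep K Q) (hthin : M.Thin)
    (hsuppV : suppV M = Set.univ) (hsuppA : suppA M = Set.univ)
    (p : ∀ v, Submodule K (M.space v)) (hp : IndecSub M p)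
    (hproper : p ≠ fun _ => ⊤)
    (hmax : ∀ r, IndecSub M r → r ≠ (fun _ => ⊤) → p ≤ r → r = p) :
    ∃ i : Q.V, (∀ a : Q.A, Q.t a ≠ i) ∧
      Iso (quotRep M p) (simple K Q i) ∧ InjectiveRep (simple K Q i) := by
  have hsucc : ∀ a, p (Q.s a) ≠ ⊥ → p (Q.t a) ≠ ⊥ := by
    intro a h
    have hinj := hthin.map_injective (hsuppA ▸ Set.mem_univ a : a ∈ suppA M)
    obtain ⟨x, hx, h0⟩ := (Submodule.ne_bot_iff _).1 h
    exact (Submodule.ne_bot_iff _).2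
      ⟨_, hp.1 a x hx, fun h => h0 (hinj (h.trans (map_zero _).symm))⟩
  obtain ⟨w, hw⟩ : ∃ w, p w = ⊥ := by
    by_contra! h
    exact hproper (funext fun v => hthin.eq_top_of_ne_bot (h v))
  obtain ⟨i, hi, hbd⟩ : ∃ i, p i = ⊥ ∧ ∀ a, p (Q.s a) = ⊥ → p (Q.t a) ≠ ⊥ → Q.s a = i := by
    by_cases h : ∃ a, p (Q.s a) = ⊥ ∧ p (Q.t a) ≠ ⊥
    · obtain ⟨b, hbs, hbt⟩ := h
      have hreach := fun a => reflTransGen_of_maximal hthin hsuppV hsuppA hp hmax (a := a)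
      exact ⟨Q.s b, hbs, fun a has hat =>
        hQ.eq_of_reflTransGen (hreach a has hat hbs) (hreach b hbs hbt has)⟩
    · exact ⟨w, hw, fun a has hat => absurd ⟨a, has, hat⟩ h⟩
  have hne : {v | p v ≠ ⊥}.Nonempty := by
    obtain ⟨v, x, hx⟩ := hp.2.1
    exact ⟨v, mem_suppV_restrictRep.1 ⟨x, hx⟩⟩
  have hother : ∀ v, v ≠ i → p v ≠ ⊥ := fun v hv =>
    hcyc.mem_of_ne hne (fun h => h hi) (fun a has _ =>
      ⟨hsucc a, fun hat hbot => has (hbd a hbot hat)⟩) hv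
  have hsource : ∀ a, Q.t a ≠ i := by
    intro a ha
    have hs : Q.s a = i := by
      by_contra h
      exact hsucc a (hother _ h) (ha ▸ hi)
    exact hQ i (.single ⟨a, hs, ha⟩)
  refine ⟨i, hsource, iso_quotRep_simple hsource
    (fun v hv => hthin.eq_top_of_ne_bot (hother v hv)) ?_, injectiveRep_simple_of_source hsource⟩
  obtain ⟨x, hx⟩ : i ∈ suppV M := hsuppV ▸ Set.mem_univ i
  have hpos : 0 < Module.finrank K (M.space i) :=
    Module.finrank_pos_iff_exists_ne_zero.2 ⟨x, hx⟩
  rw [hi, (Submodule.quotEquivOfEqBot _ rfl).finrank_eq]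
  exact le_antisymm (hthin i) hpos
end
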